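/- Let E be a real normed vector space and Ω a continuous alternating bilinear form on E. Suppose f, g : E → ℝ are twice continuously differentiable and admit differentiable Hamiltonian vector fields X, Y, i.e. Df(x)(v) = Ω(v, X(x)) and Dg(x)(v) = Ω(v, Y(x)) for all x, v ∈ E. Then the function h(x) := Ω(X(x), Y(x)) is differentiable and satisfies Dh(x)(v) = Ω(v, [X,Y](x)) for all x, v ∈ E, where [X,Y](x) := DY(x)(X(x)) − DX(x)(Y(x)); that is, the Poisson bracket of two regular observables is a regular observable generating the Lie bracket of the flows they generate. -/

import Mathlib

/-- If `f` is `C²` and `X` is a differentiable Hamiltonian vector field of `f`, the bilinear form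
`(u, v) ↦ Ω(u, DX(x)(v))` is symmetric: it is the second derivative of `f` at `x`. -/
theorem hamiltonian_fderiv_symm
    {E : Type*} [NormedAddCommGroup E] [NormedSpace ℝ E]
    (Ω : E →L[ℝ] E →L[ℝ] ℝ) {f : E → ℝ} (hf : ContDiff ℝ 2 f) {X : E → E} {x : E}
    (hXd : DifferentiableAt ℝ X x)
    (hX : ∀ x v : E, fderiv ℝ f x v = Ω v (X x)) (u v : E) :
    Ω u (fderiv ℝ X x v) = Ω v (fderiv ℝ X x u) := by
  have hflip : fderiv ℝ f = fun y => Ω.flip (X y) := by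
    ext y w
    simp [hX]
  have hsecond : fderiv ℝ (fderiv ℝ f) x = Ω.flip.comp (fderiv ℝ X x) := by
    rw [hflip]
    exact (Ω.flip.hasFDerivAt.comp x hXd.hasFDerivAt).fderiv
  have hsymm : IsSymmSndFDerivAt ℝ f x := hf.contDiffAt.isSymmSndFDerivAt (by simp)
  simpa [hsecond] using hsymm v u

/-- **The Poisson bracket of two regular observables is a regular observable
generating the Lie bracket of their flows.**  Let `Ω` be a continuous
alternating bilinear form on a real normed space `E`.  If `f, g` are `C²`
with differentiable Hamiltonian vector fields `X, Y`, then the Poisson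
bracket `h(x) = Ω(X(x), Y(x))` is differentiable and its derivative is given
by pairing with the Lie bracket `[X,Y](x) = DY(x)(X(x)) − DX(x)(Y(x))`. -/
theorem poisson_bracket_generates_lie_bracket
    {E : Type*} [NormedAddCommGroup E] [NormedSpace ℝ E]
    (Ω : E →L[ℝ] E →L[ℝ] ℝ)
    (halt : ∀ v : E, Ω v v = 0)
    (f g : E → ℝ) (hf : ContDiff ℝ 2 f) (hg : ContDiff ℝ 2 g)
    (X Y : E → E)
    (hXd : Differentiable ℝ X) (hYd : Differentiable ℝ Y)
    (hX : ∀ x v : E, fderiv ℝ f x v = Ω v (X x))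
    (hY : ∀ x v : E, fderiv ℝ g x v = Ω v (Y x)) :
    Differentiable ℝ (fun x => Ω (X x) (Y x)) ∧
    (∀ x v : E, fderiv ℝ (fun x => Ω (X x) (Y x)) x v
        = Ω v (fderiv ℝ Y x (X x) - fderiv ℝ X x (Y x))) := by
  have hasDeriv (x : E) := Ω.hasFDerivAt_of_bilinear (hXd x).hasFDerivAt (hYd x).hasFDerivAt
  refine ⟨fun x => (hasDeriv x).differentiableAt, fun x v => ?_⟩
  have hskew (a b : E) : Ω a b = -Ω b a := by
    have h := halt (a + b)
    simp only [map_add, add_apply, halt] at h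
    linarith
  have hXsymm := hamiltonian_fderiv_symm Ω hf (hXd x) hX v (Y x)
  have hYsymm := hamiltonian_fderiv_symm Ω hg (hYd x) hY v (X x)
  rw [(hasDeriv x).fderiv, map_sub, hXsymm, hYsymm, hskew (Y x)]
  simp
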